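/- arXiv:1707.07576 — 6 statements merged into one kernel-verified Lean document; each statement's English description precedes it below -/
import Mathlib

section
/- For any 𝒮-allowed permutation tuple π, any block b : Fin k, and any class c : 𝒞, the multiset of block-b rows among class-c items is invariant under the permutation: the multiset over {i : Fin n // C i = c} of the functions (fun j : {j : Fin m // g j = b} => X^π i j.1) equals the multiset over {i : Fin n // C i = c} of the functions (fun j : {j : Fin m // g j = b} => X i j.1). -/
/-- A permutation tuple is 𝒮-allowed. -/
def SAllowed {n m k : ℕ} {𝒞 : Type*} (C : Fin n → 𝒞) (g : Fin m → Fin k)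
    (π : Fin m → Equiv.Perm (Fin n)) : Prop :=
  (∀ j i, C (π j i) = C i) ∧ ∀ j j', g j = g j' → π j = π j'

/-- The column-wise permuted matrix `X^π i j = X (π j i) j`. -/
def permMat {n m : ℕ} {α : Type*} (X : Fin n → Fin m → α)
    (π : Fin m → Equiv.Perm (Fin n)) : Fin n → Fin m → α :=
  fun i j => X (π j i) j

/-- For any 𝒮-allowed permutation tuple `π`, any block `b` and any class `c`, the
multiset of block-`b` rows among class-`c` items is invariant under the permutation. -/
theorem blockClassMultiset_invariant (n m k : ℕ) (α : Type*) (𝒞 : Type*) [Fintype 𝒞] [DecidableEq 𝒞]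
    (C : Fin n → 𝒞) (g : Fin m → Fin k) (X : Fin n → Fin m → α)
    (π : Fin m → Equiv.Perm (Fin n)) (hπ : SAllowed C g π) (b : Fin k) (c : 𝒞) :
    (Finset.univ.val.map
        (fun i : {i : Fin n // C i = c} =>
          fun j : {j : Fin m // g j = b} => permMat X π i.1 j.1)) =
    (Finset.univ.val.map
        (fun i : {i : Fin n // C i = c} =>
          fun j : {j : Fin m // g j = b} => X i.1 j.1)) := by
  obtain ⟨σ, hσ, hσ'⟩ : ∃ σ : Equiv.Perm (Fin n), (∀ i, C (σ i) = C i) ∧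
      ∀ j, g j = b → π j = σ := by
    by_cases h : ∃ j, g j = b
    · obtain ⟨j, hj⟩ := h
      exact ⟨π j, hπ.1 j, fun j' hj' => hπ.2 j' j (hj'.trans hj.symm)⟩
    · exact ⟨1, fun _ => rfl, fun j hj => (h ⟨j, hj⟩).elim⟩
  let e : Equiv.Perm {i : Fin n // C i = c} :=
    σ.subtypeEquiv (fun i => by rw [hσ])
  have h1 : (fun i : {i : Fin n // C i = c} =>
          fun j : {j : Fin m // g j = b} => permMat X π i.1 j.1) =
      (fun i : {i : Fin n // C i = c} =>
          fun j : {j : Fin m // g j = b} => X i.1 j.1) ∘ e := by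
    funext i j
    simp [permMat, e, hσ' j.1 j.2]
  have h2 : (Finset.univ : Finset {i : Fin n // C i = c}).val.map e = Finset.univ.val :=
    Multiset.map_univ_val_equiv e
  rw [h1, ← Multiset.map_map, h2]
end

section
/- (Lemma 2, invariance form) For any 𝒮-allowed permutation tuple π and any data matrix X, the factorised probability is unchanged: ∏ i, (q (C i) * ∏ b, p b (fun j : {j // g j = b} => X^π i j.1) (C i)) = ∏ i, (q (C i) * ∏ b, p b (fun j : {j // g j = b} => X i j.1) (C i)). -/
/-- (Lemma 2, invariance form) For any 𝒮-allowed permutation tuple `π`, the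
factorised probability of the permuted dataset equals that of the original dataset. -/
theorem factorised_prob_perm_invariant (n m k : ℕ) (α : Type*) (𝒞 : Type*) [Fintype 𝒞]
    (C : Fin n → 𝒞) (g : Fin m → Fin k)
    (p : (b : Fin k) → ({j : Fin m // g j = b} → α) → 𝒞 → ℝ) (q : 𝒞 → ℝ)
    (X : Fin n → Fin m → α) (π : Fin m → Equiv.Perm (Fin n)) (hπ : SAllowed C g π) :
    ∏ i : Fin n, (q (C i) *
        ∏ b : Fin k, p b (fun j : {j : Fin m // g j = b} => permMat X π i j.1) (C i)) =
    ∏ i : Fin n, (q (C i) *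
        ∏ b : Fin k, p b (fun j : {j : Fin m // g j = b} => X i j.1) (C i)) := by
  obtain ⟨h1, h2⟩ := hπ
  rw [Finset.prod_mul_distrib, Finset.prod_mul_distrib]
  congr 1
  rw [Finset.prod_comm, Finset.prod_comm (s := Finset.univ (α := Fin n))]
  refine Finset.prod_congr rfl fun b _ => ?_
  by_cases hb : ∃ j, g j = b
  · obtain ⟨j₀, hj₀⟩ := hb
    rw [← Equiv.prod_comp (π j₀)
      (fun i => p b (fun j : {j : Fin m // g j = b} => X i j.1) (C i))]
    refine Finset.prod_congr rfl fun i _ => ?_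
    have hX : (fun j : {j : Fin m // g j = b} => permMat X π i j.1) =
        fun j : {j : Fin m // g j = b} => X (π j₀ i) j.1 := by
      funext j
      simp only [permMat]
      rw [h2 j.1 j₀ (j.2.trans hj₀.symm)]
    rw [hX, h1 j₀ i]
  · refine Finset.prod_congr rfl fun i _ => ?_
    congr 1
    funext j
    exact absurd ⟨j.1, j.2⟩ hb
end

section
/- (Lemma 2) All datasets in 𝒟_𝒮(X) have equal probability under the factorised distribution parametrised by 𝒮: for any data matrix X and any X' ∈ 𝒟_𝒮(X), P(X') = P(X), where P(Y) = ∏ i, (q (C i) * ∏ b, p b (fun j : {j // g j = b} => Y i j.1) (C i)). -/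
/-- The set `𝒟_𝒮(X)` of datasets generated by an 𝒮-allowed permutation of `X`. -/
def genSet {n m k : ℕ} {α : Type*} {𝒞 : Type*} (C : Fin n → 𝒞) (g : Fin m → Fin k)
    (X : Fin n → Fin m → α) : Set (Fin n → Fin m → α) :=
  {X' | ∃ π : Fin m → Equiv.Perm (Fin n), SAllowed C g π ∧ X' = permMat X π}

/-- The factorised probability of the dataset `(X, C)`. -/
def factProb {n m k : ℕ} {α : Type*} {𝒞 : Type*} [Fintype 𝒞]
    (C : Fin n → 𝒞) (g : Fin m → Fin k)
    (p : (b : Fin k) → ({j : Fin m // g j = b} → α) → 𝒞 → ℝ) (q : 𝒞 → ℝ)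
    (X : Fin n → Fin m → α) : ℝ :=
  ∏ i : Fin n, (q (C i) *
      ∏ b : Fin k, p b (fun j : {j : Fin m // g j = b} => X i j.1) (C i))

/-- (Lemma 2) All datasets in `𝒟_𝒮(X)` have equal probability under the factorised
distribution parametrised by `𝒮`. -/
theorem factorised_prob_genSet (n m k : ℕ) (α : Type*) (𝒞 : Type*) [Fintype 𝒞]
    (C : Fin n → 𝒞) (g : Fin m → Fin k)
    (p : (b : Fin k) → ({j : Fin m // g j = b} → α) → 𝒞 → ℝ) (q : 𝒞 → ℝ)
    (X X' : Fin n → Fin m → α) (hX' : X' ∈ genSet C g X) :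
    factProb C g p q X' = factProb C g p q X := by
  obtain ⟨π, ⟨hC, hg⟩, rfl⟩ := hX'
  unfold factProb
  rw [Finset.prod_mul_distrib, Finset.prod_mul_distrib]
  congr 1
  rw [Finset.prod_comm]
  conv_rhs => rw [Finset.prod_comm]
  refine Finset.prod_congr rfl fun b _ => ?_
  have h : ∃ σ : Equiv.Perm (Fin n), (∀ i, C (σ i) = C i) ∧ ∀ j, g j = b → π j = σ := by
    by_cases hb : ∃ j, g j = b
    · obtain ⟨j, hj⟩ := hb
      exact ⟨π j, hC j, fun j' hj' => hg j' j (hj'.trans hj.symm)⟩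
    · exact ⟨1, fun i => rfl, fun j hj => absurd ⟨j, hj⟩ hb⟩
  obtain ⟨σ, hσ, hπ⟩ := h
  rw [← Equiv.prod_comp σ (fun i => p b (fun j : {j : Fin m // g j = b} => X i j.1) (C i))]
  refine Finset.prod_congr rfl fun i _ => ?_
  have e : (fun j : {j : Fin m // g j = b} => permMat X π i j.1)
      = fun j : {j : Fin m // g j = b} => X (σ i) j.1 := by
    funext j
    simp only [permMat, hπ j.1 j.2]
  rw [e, hσ]
end

section
/- (Lemma 1) Sampling an 𝒮-allowed permutation tuple uniformly at random produces each dataset in 𝒟_𝒮(X) with uniform probability; concretely, for any data matrix X and any two matrices X', X'' ∈ 𝒟_𝒮(X), the number of 𝒮-allowed permutation tuples π with X^π = X' equals the number of 𝒮-allowed permutation tuples π with X^π = X''. -/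
/-- (Lemma 1) The uniform-permutation scheme produces each dataset in `𝒟_𝒮(X)` with
uniform probability: any two matrices in `𝒟_𝒮(X)` are produced by equally many
𝒮-allowed permutation tuples. -/
theorem genSet_uniform (n m k : ℕ) (α : Type*) (𝒞 : Type*) [Fintype 𝒞]
    (C : Fin n → 𝒞) (g : Fin m → Fin k) (X X' X'' : Fin n → Fin m → α)
    (hX' : X' ∈ genSet C g X) (hX'' : X'' ∈ genSet C g X) :
    Nat.card {π : Fin m → Equiv.Perm (Fin n) // SAllowed C g π ∧ permMat X π = X'} =
    Nat.card {π : Fin m → Equiv.Perm (Fin n) // SAllowed C g π ∧ permMat X π = X''} := by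
  obtain ⟨a, ha, rfl⟩ := hX'
  obtain ⟨b, hb, rfl⟩ := hX''
  have hmul : ∀ p q : Fin m → Equiv.Perm (Fin n), SAllowed C g p → SAllowed C g q →
      SAllowed C g (p * q) := by
    intro p q hp hq
    refine ⟨fun j i => ?_, fun j j' h => ?_⟩
    · simp only [Pi.mul_apply, Equiv.Perm.mul_apply]
      rw [hp.1, hq.1]
    · simp only [Pi.mul_apply]
      rw [hp.2 j j' h, hq.2 j j' h]
  have hinv : ∀ p : Fin m → Equiv.Perm (Fin n), SAllowed C g p → SAllowed C g p⁻¹ := by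
    intro p hp
    refine ⟨fun j i => ?_, fun j j' h => ?_⟩
    · have h := hp.1 j ((p⁻¹) j i)
      simpa using h.symm
    · simp only [Pi.inv_apply]
      rw [hp.2 j j' h]
  have key : ∀ a b p : Fin m → Equiv.Perm (Fin n), SAllowed C g a → SAllowed C g b →
      (SAllowed C g p ∧ permMat X p = permMat X a) →
      (SAllowed C g (p * (a⁻¹ * b)) ∧ permMat X (p * (a⁻¹ * b)) = permMat X b) := by
    intro a b p ha hb hp
    refine ⟨hmul _ _ hp.1 (hmul _ _ (hinv _ ha) hb), ?_⟩
    funext i j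
    have h := congrFun (congrFun hp.2 ((a j)⁻¹ (b j i))) j
    simpa [permMat] using h
  refine Nat.card_congr (Equiv.subtypeEquiv (Equiv.mulRight (a⁻¹ * b)) fun p => ⟨key a b p ha hb, fun h => ?_⟩)
  have h2 := key b a _ hb ha h
  have e : (Equiv.mulRight (a⁻¹ * b)) p * (b⁻¹ * a) = p := by
    simp only [Equiv.coe_mulRight]; group
  rwa [e] at h2
end

section
/- (Exchangeability under the factorised distribution) For any fixed 𝒮-allowed permutation tuple π, the permutation of the data leaves the factorised distribution invariant: for every function f : (Fin n → Fin m → α) → ℝ, the sum over all data matrices X of P(X) * f(X^π) equals the sum over all data matrices X of P(X) * f(X), where α is a finite type and P(X) = ∏ i, (q (C i) * ∏ b, p b (fun j : {j // g j = b} => X i j.1) (C i)). -/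
/-- (Exchangeability under the factorised distribution) A fixed 𝒮-allowed permutation
of the data leaves the factorised distribution invariant. -/
theorem factorised_exchangeable (n m k : ℕ) (α : Type*) [Fintype α] (𝒞 : Type*) [Fintype 𝒞]
    (C : Fin n → 𝒞) (g : Fin m → Fin k)
    (p : (b : Fin k) → ({j : Fin m // g j = b} → α) → 𝒞 → ℝ) (q : 𝒞 → ℝ)
    (π : Fin m → Equiv.Perm (Fin n)) (hπ : SAllowed C g π)
    (f : (Fin n → Fin m → α) → ℝ) :
    ∑ X : Fin n → Fin m → α, factProb C g p q X * f (permMat X π) =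
    ∑ X : Fin n → Fin m → α, factProb C g p q X * f X := by
  have key : ∀ X, factProb C g p q (permMat X π) = factProb C g p q X := by
    intro X
    unfold factProb
    rw [Finset.prod_mul_distrib, Finset.prod_mul_distrib]
    congr 1
    rw [Finset.prod_comm]
    conv_rhs => rw [Finset.prod_comm]
    refine Finset.prod_congr rfl fun b _ => ?_
    by_cases hb : ∃ j, g j = b
    · obtain ⟨j₀, hj₀⟩ := hb
      refine Fintype.prod_equiv (π j₀) _ _ fun i => ?_
      rw [hπ.1 j₀ i]
      congr 1
      funext j
      simp only [permMat]
      rw [hπ.2 j.1 j₀ (j.2.trans hj₀.symm)]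
    · refine Finset.prod_congr rfl fun i _ => ?_
      congr 1
      funext j
      exact absurd ⟨j.1, j.2⟩ hb
  let e : (Fin n → Fin m → α) ≃ (Fin n → Fin m → α) :=
    { toFun := fun X => permMat X π
      invFun := fun X => permMat X (fun j => (π j).symm)
      left_inv := fun X => by funext i j; simp [permMat]
      right_inv := fun X => by funext i j; simp [permMat] }
  refine Fintype.sum_equiv e _ _ fun X => ?_
  change _ = factProb C g p q (permMat X π) * f (permMat X π)
  rw [key]
end

section
/- If the block assignment g : Fin m → Fin k is surjective, then the number of 𝒮-allowed permutation tuples equals (∏ c : 𝒞, (n_c)!)^k, where n_c is the number of items i with C i = c. -/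
/-- If the block assignment `g` is surjective, the number of 𝒮-allowed permutation
tuples equals `(∏ c, (n_c)!)^k`, where `n_c` is the number of items of class `c`. -/
theorem card_sAllowed (n m k : ℕ) (𝒞 : Type*) [Fintype 𝒞]
    (C : Fin n → 𝒞) (g : Fin m → Fin k) (hg : Function.Surjective g) :
    Nat.card {π : Fin m → Equiv.Perm (Fin n) // SAllowed C g π} =
    (∏ c : 𝒞, (Nat.card {i : Fin n // C i = c}).factorial) ^ k := by
  classical
  have h1 : Nat.card {p : Equiv.Perm (Fin n) // C ∘ p = C} =
      ∏ c : 𝒞, (Nat.card {i : Fin n // C i = c}).factorial := by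
    simp only [Nat.card_eq_fintype_card]
    exact DomMulAct.stabilizer_card C
  let e : {π : Fin m → Equiv.Perm (Fin n) // SAllowed C g π} ≃
      (Fin k → {p : Equiv.Perm (Fin n) // C ∘ p = C}) :=
    { toFun := fun π b => ⟨π.1 (Function.surjInv hg b),
        funext fun i => π.2.1 (Function.surjInv hg b) i⟩
      invFun := fun f => ⟨fun j => (f (g j)).1,
        fun j i => congrFun (f (g j)).2 i, fun j j' h => by simp only [h]⟩
      left_inv := fun π => Subtype.ext (funext fun j =>
        π.2.2 _ _ (Function.surjInv_eq hg (g j)))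
      right_inv := fun f => funext fun b => Subtype.ext (by
        simp only [Function.surjInv_eq hg b]) }
  rw [Nat.card_congr e, Nat.card_fun, h1, Nat.card_fin]
end
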